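/- arXiv:1109.4387 — 2 statements merged into one kernel-verified Lean document; each statement's English description precedes it below -/
import Mathlib

section
/- Suppose v_0 →^{x_1} v_1 →^{x_2} ⋯ →^{x_r} v_r is a path in the Ufnarovskii graph Q whose consecutive arrows carry the labels x_1, …, x_r, and let v_r be the terminal vertex, a legal word of length ℓ. Then the concatenated word x_1 x_2 ⋯ x_r v_r is a legal word. -/
/-! Basic setup for monomial algebras and the Ufnarovskii graph.

`G` is the set of letters, words are elements obtained as lists of letters,
`F` is the finite set of forbidden words.  A word is illegal if it contains a
forbidden word as a contiguous subword (equivalently, lies in the two-sided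
ideal generated by `F`), and legal otherwise.  The Ufnarovskii graph has the
legal words of length `ℓ` as vertices and the legal words of length `ℓ + 1`
as arrows, where the arrow corresponding to such a word `w` goes from the
word consisting of the first `ℓ` letters of `w` to the word consisting of the
last `ℓ` letters of `w`, and is labeled by the first letter of `w`. -/

namespace Ufnarovskii

variable {G : Type}

/-- A word is *illegal* if it contains a forbidden word as a contiguous subword;
equivalently, if it lies in the two-sided ideal generated by the forbidden words. -/
def Illegal (F : Finset (List G)) (w : List G) : Prop :=
  ∃ u t v, t ∈ F ∧ w = u ++ t ++ v

/-- A word is *legal* if it is not illegal. -/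
def Legal (F : Finset (List G)) (w : List G) : Prop :=
  ¬ Illegal F w

/-- The vertices of the Ufnarovskii graph: legal words of length `ℓ`. -/
def Vert (F : Finset (List G)) (ℓ : ℕ) : Type :=
  {w : List G // Legal F w ∧ w.length = ℓ}

/-- The quiver structure on the Ufnarovskii graph: an arrow from `s` to `t` is
(the datum of) a legal word `w` of length `ℓ + 1` whose first `ℓ` letters form `s`
and whose last `ℓ` letters form `t` (that is, `w = s ++ [y] = [x] ++ t` for some
letters `x`, `y`). -/
instance instQuiverVert (F : Finset (List G)) (ℓ : ℕ) : Quiver (Vert F ℓ) where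
  Hom s t := {w : List G // Legal F w ∧ w.length = ℓ + 1 ∧ w.take ℓ = s.1 ∧ w.drop 1 = t.1}

/-- The label of an arrow, as a one-letter word: the first letter of the
corresponding legal word of length `ℓ + 1`. -/
def arrowLabel {F : Finset (List G)} {ℓ : ℕ} {s t : Vert F ℓ} (a : s ⟶ t) : List G :=
  a.1.take 1

/-- The label of a path: the concatenation of the labels of its arrows. -/
def pathLabel {F : Finset (List G)} {ℓ : ℕ} {s : Vert F ℓ} :
    ∀ {t : Vert F ℓ}, Quiver.Path s t → List G
  | _, Quiver.Path.nil => []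
  | _, Quiver.Path.cons p a => pathLabel p ++ arrowLabel a

end Ufnarovskii

namespace Ufnarovskii

/-- A word is illegal exactly when some forbidden word is an infix of it. -/
theorem illegal_iff_exists_infix {G : Type} {F : Finset (List G)} {w : List G} :
    Illegal F w ↔ ∃ t ∈ F, t <:+: w :=
  ⟨fun ⟨u, t, v, ht, h⟩ => ⟨t, ht, u, v, h.symm⟩,
    fun ⟨t, ht, u, v, h⟩ => ⟨u, t, v, ht, h.symm⟩⟩

/-- If every forbidden word has length at most `(s ++ [y]).length`, then a word `A ++ s ++ [y]`
is legal as soon as both `A ++ s` and `s ++ [y]` are. -/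
theorem Legal.append_singleton {G : Type} {F : Finset (List G)} {A s : List G} {y : G}
    (hlen : ∀ w ∈ F, w.length ≤ s.length + 1) (hAs : Legal F (A ++ s))
    (hsy : Legal F (s ++ [y])) : Legal F (A ++ (s ++ [y])) := by
  intro h
  obtain ⟨t, ht, hinf⟩ := illegal_iff_exists_infix.1 h
  rw [← List.append_assoc, List.infix_concat_iff] at hinf
  rcases hinf with hsuf | hinf
  · refine hsy (illegal_iff_exists_infix.2 ⟨t, ht, List.IsSuffix.isInfix ?_⟩)
    exact List.suffix_of_suffix_length_le hsuf ⟨A, by simp⟩ (by simpa using hlen t ht)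
  · exact hAs (illegal_iff_exists_infix.2 ⟨t, ht, hinf⟩)

/-- Following an arrow replaces its source by the word of length `ℓ + 1` representing it. -/
theorem arrowLabel_append_target {G : Type} {F : Finset (List G)} {ℓ : ℕ} {s t : Vert F ℓ}
    (a : s ⟶ t) : arrowLabel a ++ t.1 = a.1 :=
  (congrArg (a.1.take 1 ++ ·) a.2.2.2.2.symm).trans (List.take_append_drop 1 a.1)

/-- The word representing an arrow extends its source by one letter on the right. -/
theorem exists_eq_source_append_singleton {G : Type} {F : Finset (List G)} {ℓ : ℕ}
    {s t : Vert F ℓ} (a : s ⟶ t) : ∃ y, a.1 = s.1 ++ [y] := by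
  obtain ⟨y, hy⟩ := List.length_eq_one_iff.1 (show (a.1.drop ℓ).length = 1 by
    rw [List.length_drop, a.2.2.1]; omega)
  exact ⟨y, (List.take_append_drop ℓ a.1).symm.trans (congrArg₂ (· ++ ·) a.2.2.2.1 hy)⟩

end Ufnarovskii

open Ufnarovskii in
/-- If `v₀ →^{x₁} v₁ →^{x₂} ⋯ →^{x_r} v_r` is a path in the Ufnarovskii graph whose
consecutive arrows carry the labels `x₁, …, x_r` (so its label is `x₁⋯x_r`), and
`v_r` is the terminal vertex, a legal word of length `ℓ`, then the concatenated
word `x₁ x₂ ⋯ x_r v_r` is a legal word. -/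
theorem statement_5 {G : Type} (F : Finset (List G)) (ℓ : ℕ)
    (hlen : ∀ w ∈ F, 2 ≤ w.length ∧ w.length ≤ ℓ + 1) (hmax : ∃ w ∈ F, w.length = ℓ + 1)
    (v₀ vr : Vert F ℓ) (p : Quiver.Path v₀ vr) :
    Legal F (pathLabel p ++ vr.1) := by
  induction p with
  | nil => exact v₀.2.1
  | @cons s t p a ih =>
    rw [pathLabel, List.append_assoc, arrowLabel_append_target]
    obtain ⟨y, hy⟩ := exists_eq_source_append_singleton a
    rw [hy]
    exact ih.append_singleton (fun w hw => by rw [s.2.2]; exact (hlen w hw).2) (hy ▸ a.2.1)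
end

section
/- If x_1⋯x_r is an illegal word, then there are no paths in the Ufnarovskii graph Q labeled x_1⋯x_r. Equivalently, if there exists a path in Q labeled x_1⋯x_r, then the word x_1⋯x_r is legal. -/
namespace Ufnarovskii

variable {G : Type} {F : Finset (List G)} {ℓ : ℕ}

theorem illegal_iff_exists_isInfix {w : List G} : Illegal F w ↔ ∃ f ∈ F, f <:+: w := by
  constructor
  · rintro ⟨u, f, v, hf, rfl⟩
    exact ⟨f, hf, u, v, rfl⟩
  · rintro ⟨f, hf, u, v, rfl⟩
    exact ⟨u, f, v, hf, rfl⟩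

theorem Illegal.of_isInfix {w w' : List G} (h : Illegal F w) (hw : w <:+: w') :
    Illegal F w' := by
  rw [illegal_iff_exists_isInfix] at h ⊢
  obtain ⟨f, hf, hfw⟩ := h
  exact ⟨f, hf, hfw.trans hw⟩

/-- Legal words overlapping in `ℓ` letters glue to a legal word, when forbidden words have
length at most `ℓ + 1`. -/
theorem Legal.append_concat (hlen : ∀ f ∈ F, f.length ≤ ℓ + 1) {u s : List G} {y : G}
    (hs : s.length = ℓ) (hus : Legal F (u ++ s)) (hsy : Legal F (s ++ [y])) :
    Legal F (u ++ (s ++ [y])) := by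
  intro h
  obtain ⟨f, hf, hfw⟩ := illegal_iff_exists_isInfix.1 h
  rw [← List.append_assoc, List.infix_concat_iff] at hfw
  rcases hfw with hfw | hfw
  · rw [List.append_assoc] at hfw
    have hsuf : f <:+ s ++ [y] :=
      List.suffix_of_suffix_length_le hfw (List.suffix_append u _)
        (by simpa [hs] using hlen f hf)
    exact hsy (illegal_iff_exists_isInfix.2 ⟨f, hf, hsuf.isInfix⟩)
  · exact hus (illegal_iff_exists_isInfix.2 ⟨f, hf, hfw⟩)

theorem exists_eq_concat_of_hom {s t : Vert F ℓ} (a : s ⟶ t) : ∃ y, a.1 = s.1 ++ [y] := by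
  obtain ⟨w, -, hw, hs, -⟩ := a
  have hd : (w.drop ℓ).length = 1 := by simp [hw]
  obtain ⟨y, hy⟩ := List.length_eq_one_iff.1 hd
  refine ⟨y, ?_⟩
  change w = _
  exact (List.take_append_drop ℓ w).symm.trans (congrArg₂ (· ++ ·) hs hy)

theorem arrowLabel_append {s t : Vert F ℓ} (a : s ⟶ t) : arrowLabel a ++ t.1 = a.1 :=
  (congrArg (arrowLabel a ++ ·) a.2.2.2.2.symm).trans (List.take_append_drop 1 a.1)

theorem legal_pathLabel_append (hlen : ∀ f ∈ F, f.length ≤ ℓ + 1) {s t : Vert F ℓ}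
    (p : Quiver.Path s t) : Legal F (pathLabel p ++ t.1) := by
  induction p with
  | nil => exact s.2.1
  | @cons b c p a ih =>
    obtain ⟨y, hy⟩ := exists_eq_concat_of_hom a
    rw [pathLabel, List.append_assoc, arrowLabel_append, hy]
    exact Legal.append_concat hlen b.2.2 ih (hy ▸ a.2.1)

end Ufnarovskii

open Ufnarovskii in
/-- If `x₁⋯x_r` is an illegal word, then there are no paths in the Ufnarovskii
graph labeled `x₁⋯x_r`. -/
theorem statement_6 {G : Type} (F : Finset (List G)) (ℓ : ℕ)
    (hlen : ∀ w ∈ F, 2 ≤ w.length ∧ w.length ≤ ℓ + 1) (hmax : ∃ w ∈ F, w.length = ℓ + 1)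
    (xs : List G) (h : Illegal F xs) :
    ¬ ∃ (s t : Vert F ℓ) (p : Quiver.Path s t), pathLabel p = xs := by
  rintro ⟨s, t, p, rfl⟩
  exact legal_pathLabel_append (fun w hw => (hlen w hw).2) p
    (h.of_isInfix (List.prefix_append _ _).isInfix)
end
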